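/- arXiv:2601.17684 — 3 statements merged into one kernel-verified Lean document; each statement's English description precedes it below -/
import Mathlib

section
/- Let X be a type, B : X → (ℕ → Bool) an injective assignment of infinite binary sequences (longforms) to tokens, x₀ ∈ X a token, and U a finite subset of X with x₀ ∉ U. Let m = max over x ∈ U of B(x) ⋆ B(x₀) (with m = 0 if U is empty), and let Z : ℕ → Bool be any sequence such that Z(i) = B(x₀)(i) for all i < m + 1 and Z(m + 1) = ¬B(x₀)(m + 1). Then B(x₀) ⋆ Z = m + 1, while B(x) ⋆ Z ≤ m for every x ∈ U; consequently x₀ is the unique element of U ∪ {x₀} maximizing x ↦ B(x) ⋆ Z. -/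
/-- The longest-common-prefix length `a ⋆ b` of two infinite binary sequences:
the largest `j : ℕ∞` (possibly `⊤`) such that `a i = b i` for all `i < j`.
Equivalently, the index of the first disagreement. -/
noncomputable def lcp (a b : ℕ → Bool) : ℕ∞ :=
  ⨅ i ∈ {i : ℕ | a i ≠ b i}, (i : ℕ∞)

/-- **Combinatorial core of Proposition 1.** Let `B` be an injective assignment
of longforms to tokens, `x₀` a token, and `U` a finite set of tokens not
containing `x₀`. Let `m` be the maximum over `x ∈ U` of `B(x) ⋆ B(x₀)` (which
is `0` when `U` is empty), and let `Z` agree with `B(x₀)` at all indices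
`i < m + 1` and be flipped at index `m + 1`. Then `B(x₀) ⋆ Z = m + 1` while
`B(x) ⋆ Z ≤ m` for every `x ∈ U`; consequently `x₀` is the unique element of
`U ∪ {x₀}` maximizing `x ↦ B(x) ⋆ Z`. -/
theorem decoder_recovers_token {X : Type*} [DecidableEq X] (B : X → (ℕ → Bool))
    (hB : Function.Injective B) (x₀ : X) (U : Finset X) (hx₀ : x₀ ∉ U)
    (m : ℕ) (hm : (m : ℕ∞) = U.sup fun x => lcp (B x) (B x₀))
    (Z : ℕ → Bool)
    (hagree : ∀ i < m + 1, Z i = B x₀ i)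
    (hflip : Z (m + 1) = !B x₀ (m + 1)) :
    lcp (B x₀) Z = ((m + 1 : ℕ) : ℕ∞) ∧
    (∀ x ∈ U, lcp (B x) Z ≤ (m : ℕ∞)) ∧
    (∀ x ∈ insert x₀ U, x ≠ x₀ → lcp (B x) Z < lcp (B x₀) Z) := by
  have h1 : lcp (B x₀) Z = ((m + 1 : ℕ) : ℕ∞) := by
    apply le_antisymm
    · exact iInf₂_le (m + 1) (by simp [hflip])
    · refine le_iInf₂ fun i hi => ?_
      by_contra hlt
      have hlt' : i < m + 1 := by
        have := not_le.mp hlt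
        exact_mod_cast this
      exact hi (hagree i hlt').symm
  have h2 : ∀ x ∈ U, lcp (B x) Z ≤ (m : ℕ∞) := by
    intro x hx
    have hle : lcp (B x) (B x₀) ≤ (m : ℕ∞) := by
      rw [hm]
      exact Finset.le_sup (f := fun x => lcp (B x) (B x₀)) hx
    by_contra hcon
    have hge : ((m + 1 : ℕ) : ℕ∞) ≤ lcp (B x) (B x₀) := by
      refine le_iInf₂ fun i hi => ?_
      by_contra hlt
      have hlt' : i < m + 1 := by
        have := not_le.mp hlt
        exact_mod_cast this
      apply hcon
      refine (iInf₂_le i ?_).trans (b := (i : ℕ∞)) ?_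
      · change B x i ≠ Z i
        rw [hagree i hlt']
        exact hi
      · exact_mod_cast Nat.lt_succ_iff.mp hlt'
    have h3 : m + 1 ≤ m := by exact_mod_cast hge.trans hle
    omega
  refine ⟨h1, h2, fun x hx hne => ?_⟩
  rw [h1]
  refine (h2 x (Finset.mem_of_mem_insert_of_ne hx hne)).trans_lt ?_
  exact_mod_cast Nat.lt_succ_self m
end

section
/- Define S(n) = Σ_{i=1}^{∞} [1 − (1 − 2^{−i})ⁿ] for natural numbers n ≥ 1. There exists a constant C > 0 such that for all n ≥ 2, |S(n) − log₂ n| ≤ C. -/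
/-- `S n = Σ_{i=1}^{∞} [1 − (1 − 2^{−i})ⁿ]`. -/
noncomputable def S (n : ℕ) : ℝ :=
  ∑' i : ℕ, (1 - (1 - (2 : ℝ)⁻¹ ^ (i + 1)) ^ n)

lemma S_aux_pow_le (x : ℝ) (hx : 0 < x) (hx1 : x ≤ 1) (n : ℕ) (hn : 0 < n) :
    (1 - x) ^ n ≤ 1 / (n * x) := by
  have hn' : (0 : ℝ) < n := by exact_mod_cast hn
  rw [le_div_iff₀ (by positivity)]
  have h0 : 0 ≤ (1 - x) ^ n := pow_nonneg (by linarith) n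
  have h1 : 1 + (n : ℝ) * x ≤ (1 + x) ^ n := one_add_mul_le_pow (by linarith) n
  have h2 : (1 - x) ^ n * (1 + x) ^ n ≤ 1 := by
    rw [← mul_pow]
    exact pow_le_one₀ (by nlinarith) (by nlinarith)
  nlinarith [mul_le_mul_of_nonneg_left h1 h0]

lemma S_aux_sum (k : ℕ) : ∑ i ∈ Finset.range k, (2 : ℝ) ^ (i + 1) ≤ 2 * 2 ^ k := by
  induction k with
  | zero => simp
  | succ k ih => rw [Finset.sum_range_succ]; ring_nf at ih ⊢; linarith

/-- **Proposition 2, first part:** `S(n) = log₂ n + Θ(1)`, i.e. there is a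
constant `C > 0` with `|S(n) − log₂ n| ≤ C` for all `n ≥ 2`. -/
theorem S_sub_log_bounded :
    ∃ C : ℝ, 0 < C ∧ ∀ n : ℕ, 2 ≤ n → |S n - Real.logb 2 n| ≤ C := by
  refine ⟨3, by norm_num, fun n hn => ?_⟩
  have hn' : (0 : ℝ) < n := by exact_mod_cast (by omega : 0 < n)
  set k := Nat.log 2 n with hk
  have hk1 : (2 : ℝ) ^ k ≤ n := by exact_mod_cast Nat.pow_log_le_self 2 (by omega : n ≠ 0)
  have hk2 : (n : ℝ) < 2 ^ (k + 1) := by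
    exact_mod_cast Nat.lt_pow_succ_log_self (by norm_num : 1 < 2) n
  have hl1 : (k : ℝ) ≤ Real.logb 2 n := by
    rw [Real.le_logb_iff_rpow_le (by norm_num) hn', Real.rpow_natCast]; exact hk1
  have hl2 : Real.logb 2 n ≤ k + 1 := by
    rw [Real.logb_le_iff_le_rpow (by norm_num) hn']
    have : ((k : ℝ) + 1) = ((k + 1 : ℕ) : ℝ) := by push_cast; rfl
    rw [this, Real.rpow_natCast]; exact hk2.le
  set f : ℕ → ℝ := fun i => 1 - (1 - (2 : ℝ)⁻¹ ^ (i + 1)) ^ n with hf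
  have hx0 : ∀ i : ℕ, (0 : ℝ) < (2 : ℝ)⁻¹ ^ (i + 1) := fun i => by positivity
  have hx1 : ∀ i : ℕ, (2 : ℝ)⁻¹ ^ (i + 1) ≤ 1 := fun i =>
    pow_le_one₀ (by norm_num) (by norm_num)
  have f0 : ∀ i, 0 ≤ f i := fun i => by
    have := pow_le_one₀ (n := n) (by linarith [hx1 i] : (0 : ℝ) ≤ 1 - (2 : ℝ)⁻¹ ^ (i + 1))
      (by linarith [hx0 i])
    simp only [hf]; linarith
  have f1 : ∀ i, f i ≤ 1 := fun i => by
    have := pow_nonneg (by linarith [hx1 i] : (0 : ℝ) ≤ 1 - (2 : ℝ)⁻¹ ^ (i + 1)) n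
    simp only [hf]; linarith
  have f2 : ∀ i, f i ≤ n * (2 : ℝ)⁻¹ ^ (i + 1) := fun i => by
    have := one_add_mul_le_pow (a := -(2 : ℝ)⁻¹ ^ (i + 1)) (by linarith [hx1 i]) n
    rw [← sub_eq_add_neg] at this
    simp only [hf]; linarith
  have hg : HasSum (fun i : ℕ => (2 : ℝ)⁻¹ ^ i) 2 := by
    have := hasSum_geometric_two
    simpa [one_div] using this
  have hsum : Summable f := by
    refine Summable.of_nonneg_of_le f0 f2 ?_
    exact ((summable_nat_add_iff 1).2 hg.summable).mul_left _
  have hS : S n = ∑ i ∈ Finset.range k, f i + ∑' i, f (i + k) :=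
    (hsum.sum_add_tsum_nat_add k).symm
  have ht0 : 0 ≤ ∑' i, f (i + k) := tsum_nonneg fun i => f0 _
  have ht2 : ∑' i, f (i + k) ≤ 2 := by
    have hG := hg.mul_left ((n : ℝ) * (2 : ℝ)⁻¹ ^ (k + 1))
    have h1 : ∑' i, f (i + k) ≤ (n : ℝ) * (2 : ℝ)⁻¹ ^ (k + 1) * 2 := by
      rw [← hG.tsum_eq]
      refine Summable.tsum_le_tsum (fun i => (f2 _).trans (le_of_eq (by ring)))
        ((summable_nat_add_iff k).2 hsum) hG.summable
    have h2 : (n : ℝ) * (2 : ℝ)⁻¹ ^ (k + 1) ≤ 1 := by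
      rw [inv_pow, ← div_eq_mul_inv, div_le_one (by positivity)]; exact hk2.le
    linarith
  have hh1 : ∑ i ∈ Finset.range k, f i ≤ k := by
    refine (Finset.sum_le_sum fun i _ => f1 i).trans ?_
    simp
  have hh2 : (k : ℝ) - 2 ≤ ∑ i ∈ Finset.range k, f i := by
    have h1 : ∑ i ∈ Finset.range k, (1 - (2 : ℝ) ^ (i + 1) / n) ≤ ∑ i ∈ Finset.range k, f i := by
      refine Finset.sum_le_sum fun i _ => ?_
      have := S_aux_pow_le _ (hx0 i) (hx1 i) n (by omega)
      have e : 1 / ((n : ℝ) * (2 : ℝ)⁻¹ ^ (i + 1)) = (2 : ℝ) ^ (i + 1) / n := by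
        rw [inv_pow]; field_simp
      rw [e] at this
      simp only [hf]; linarith
    rw [Finset.sum_sub_distrib, ← Finset.sum_div] at h1
    have h2 : (∑ i ∈ Finset.range k, (2 : ℝ) ^ (i + 1)) / n ≤ 2 := by
      rw [div_le_iff₀ hn']; linarith [S_aux_sum k]
    simp at h1
    linarith
  rw [abs_le, hS]
  constructor <;> linarith
end

section
/- Define S(n) = Σ_{i=1}^{∞} [1 − (1 − 2^{−i})ⁿ] for natural numbers n ≥ 1. Then limsup_{n → ∞} (S(n) − log₂ n) ≤ 0.33276. -/
lemma gamma_norm_sq (y : ℝ) (hy : y ≠ 0) :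
    ‖Complex.Gamma (1 + (y:ℂ) * Complex.I)‖ ^ 2 = Real.pi * y / Real.sinh (Real.pi * y) := by
  have hy' : (y:ℂ) * Complex.I ≠ 0 := by
    simp [hy]
  have h1 : Complex.Gamma (1 + (y:ℂ) * Complex.I) = (y * Complex.I) * Complex.Gamma (y * Complex.I) := by
    rw [add_comm, Complex.Gamma_add_one _ hy']
  have h2 : (starRingEnd ℂ) (Complex.Gamma (1 + (y:ℂ) * Complex.I)) =
      Complex.Gamma (1 - y * Complex.I) := by
    rw [← Complex.Gamma_conj]; simp [sub_eq_add_neg]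
  have h3 := Complex.mul_conj (Complex.Gamma (1 + (y:ℂ) * Complex.I))
  rw [h2, h1, mul_assoc, Complex.Gamma_mul_Gamma_one_sub, ← h1, ← mul_assoc, Complex.sin_mul_I,
    Complex.normSq_eq_norm_sq] at h3
  have hs : Real.sinh (Real.pi * y) ≠ 0 := by
    rw [Ne, Real.sinh_eq_zero]; exact mul_ne_zero Real.pi_ne_zero hy
  have : ((‖Complex.Gamma (1 + (y:ℂ) * Complex.I)‖ ^ 2 : ℝ) : ℂ) = ((Real.pi * y / Real.sinh (Real.pi * y) : ℝ) : ℂ) := by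
    rw [← h3]
    have hs' : Complex.sinh (Real.pi * y) ≠ 0 := by
      exact_mod_cast hs
    push_cast
    field_simp
  exact_mod_cast this

lemma exp_big : (1460000 : ℝ) ≤ Real.exp 14.235 := by
  have h1 : Real.exp 14.235 = Real.exp 1 ^ 14 * Real.exp 0.235 := by
    rw [← Real.exp_nat_mul, ← Real.exp_add]; norm_num
  have h2 : (1.2626 : ℝ) ≤ Real.exp 0.235 := by
    have := Real.quadratic_le_exp_of_nonneg (x := 0.235) (by norm_num)
    norm_num at this ⊢; linarith
  have h3 : (2.718281828 : ℝ) ^ 14 ≤ Real.exp 1 ^ 14 := by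
    have := Real.exp_one_gt_d9
    gcongr
    norm_num at this ⊢; linarith
  rw [h1]
  calc (1460000 : ℝ) ≤ 2.718281828 ^ 14 * 1.2626 := by norm_num
    _ ≤ _ := by gcongr

/-- Decay of `Γ(1 + 2π i n / log 2)`. -/
lemma gamma_bound (n : ℕ) (hn : n ≠ 0) (y : ℝ) (hy : |y| = 2 * Real.pi * n / Real.log 2) :
    ‖Complex.Gamma (1 + (y:ℂ) * Complex.I)‖ ≤ 0.0000052 * (1/100) ^ (n - 1) := by
  have hl1 := Real.log_two_gt_d9
  have hl2 := Real.log_two_lt_d9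
  have hp1 := Real.pi_gt_d6
  have hp2 := Real.pi_lt_d6
  have hn1 : (1:ℝ) ≤ n := by exact_mod_cast Nat.one_le_iff_ne_zero.mpr hn
  set a := Real.pi * |y| with ha
  have ha' : a = 2 * Real.pi ^ 2 / Real.log 2 * n := by rw [ha, hy]; ring
  have hA1 : 28.47 ≤ 2 * Real.pi ^ 2 / Real.log 2 := by
    rw [le_div_iff₀ (by linarith)]; nlinarith
  have hA2 : 2 * Real.pi ^ 2 / Real.log 2 ≤ 28.48 := by
    rw [div_le_iff₀ (by linarith)]; nlinarith
  have ha1 : 28.47 * n ≤ a := by rw [ha']; gcongr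
  have ha2 : a ≤ 28.48 * n := by rw [ha']; gcongr
  have hy0 : y ≠ 0 := by
    intro h; rw [h] at ha; simp at ha; linarith
  have key : ‖Complex.Gamma (1 + (y:ℂ) * Complex.I)‖ ^ 2 = a / Real.sinh a := by
    rw [gamma_norm_sq y hy0, ha]
    rcases abs_choice y with h | h <;> rw [h]
    simp
  set E := Real.exp 14.235 with hE
  have hEb : (1460000:ℝ) ≤ E := exp_big
  have hexp : E ^ (2 * n) ≤ Real.exp a := by
    rw [hE, ← Real.exp_nat_mul]
    apply Real.exp_le_exp.mpr
    push_cast; linarith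
  have hE1 : (1:ℝ) ≤ E := by linarith
  have hsinh : E ^ (2 * n) / 2.001 ≤ Real.sinh a := by
    rw [Real.sinh_eq]
    have h1 : Real.exp (-a) ≤ 1 := Real.exp_le_one_iff.mpr (by nlinarith)
    have h2 : E ≤ E ^ (2 * n) := le_self_pow₀ hE1 (by omega)
    rw [div_le_div_iff₀ (by norm_num) (by norm_num)]
    nlinarith
  have hq : ‖Complex.Gamma (1 + (y:ℂ) * Complex.I)‖ ^ 2 ≤ (7.55 * n / E ^ n) ^ 2 := by
    rw [key]
    calc a / Real.sinh a ≤ (28.48 * n) / (E ^ (2 * n) / 2.001) := by gcongr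
      _ = 56.98848 * n / E ^ (2*n) := by field_simp; norm_num
      _ ≤ 57.0025 * n ^ 2 / E ^ (2*n) := by
        apply div_le_div_of_nonneg_right _ (by positivity)
        nlinarith
      _ = _ := by rw [div_pow, mul_pow, ← pow_mul, mul_comm n 2]; norm_num
  have hq2 : ‖Complex.Gamma (1 + (y:ℂ) * Complex.I)‖ ≤ 7.55 * n / E ^ n :=
    le_of_sq_le_sq hq (by positivity)
  refine hq2.trans ?_
  obtain ⟨k, rfl⟩ := Nat.exists_eq_succ_of_ne_zero hn
  have hk : ((k.succ : ℕ) : ℝ) ≤ 2 ^ k := by exact_mod_cast Nat.lt_two_pow_self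
  simp only [Nat.succ_sub_one]
  rw [div_le_iff₀ (by positivity)]
  calc 7.55 * ((k.succ : ℕ) : ℝ) ≤ 7.55 * 2 ^ k := by gcongr
    _ ≤ 7.55 * (1/100 * 1460000) ^ k := by gcongr; norm_num
    _ ≤ (0.0000052 * 1460000) * (1/100 * 1460000) ^ k := by gcongr; norm_num
    _ = 0.0000052 * (1/100) ^ k * 1460000 ^ (k+1) := by rw [mul_pow]; ring
    _ ≤ _ := by gcongr

/-- Upper bound for the dyadic constant at `1`. -/
lemma term_bound (p : ℝ) (h0 : 0 ≤ p) (h1 : p ≤ 1) : 1 - Real.exp (-p) ≤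
    p - p^2/2 + p^3/6 - p^4/24 + p^5/120 - p^6/720 + p^7/5040 + p^8 * (9/322560) := by
  have h := Real.exp_bound (x := -p) (by rw [abs_neg, abs_of_nonneg h0]; exact h1) (n := 8) (by norm_num)
  rw [abs_neg, abs_of_nonneg h0] at h
  have h2 := (abs_le.mp h).1
  simp [Finset.sum_range_succ, Nat.factorial] at h2
  nlinarith

lemma hasSum_pow (k : ℕ) (hk : k ≠ 0) :
    HasSum (fun i : ℕ => ((2:ℝ)⁻¹ ^ (i+1)) ^ k) (1 / (2 ^ k - 1)) := by
  have h2 : (1:ℝ) < 2 ^ k := one_lt_pow₀ (by norm_num) hk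
  have h := (hasSum_geometric_of_lt_one (r := ((2:ℝ)⁻¹) ^ k) (by positivity)
    (pow_lt_one₀ (by norm_num) (by norm_num) hk)).mul_left (((2:ℝ)⁻¹) ^ k)
  have e1 : (fun i : ℕ => ((2:ℝ)⁻¹ ^ (i+1)) ^ k) = fun i : ℕ => ((2:ℝ)⁻¹ ^ k) * ((2:ℝ)⁻¹ ^ k) ^ i := by
    ext i; rw [← pow_mul, ← pow_mul, ← pow_add]; congr 1; ring
  have e2 : 1 / ((2:ℝ) ^ k - 1) = (2:ℝ)⁻¹ ^ k * (1 - (2:ℝ)⁻¹ ^ k)⁻¹ := by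
    have : (2:ℝ)^k - 1 ≠ 0 := by linarith
    rw [inv_pow]; field_simp
  rw [e1, e2]; exact h

lemma summable_F (y : ℝ) (hy : 0 ≤ y) :
    Summable (fun i : ℕ => 1 - Real.exp (-(y * (2:ℝ)⁻¹ ^ (i+1)))) := by
  refine Summable.of_nonneg_of_le (fun i => ?_) (fun i => ?_)
    (((hasSum_pow 1 one_ne_zero).summable).mul_left y)
  · have : Real.exp (-(y * (2:ℝ)⁻¹ ^ (i+1))) ≤ 1 := Real.exp_le_one_iff.mpr (by
      have : 0 ≤ y * (2:ℝ)⁻¹ ^ (i+1) := by positivity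
      linarith)
    linarith
  · have := Real.add_one_le_exp (-(y * (2:ℝ)⁻¹ ^ (i+1)))
    simp only [pow_one]; linarith

lemma A_bound : ∑' i : ℕ, (1 - Real.exp (-(1 * (2:ℝ)⁻¹ ^ (i+1)))) ≤
    1 - 1/3/2 + 1/7/6 - 1/15/24 + 1/31/120 - 1/63/720 + 1/127/5040 + 1/255 * (9/322560) := by
  have H := ((((((((hasSum_pow 1 (by norm_num)).sub ((hasSum_pow 2 (by norm_num)).div_const 2)).add
    ((hasSum_pow 3 (by norm_num)).div_const 6)).sub ((hasSum_pow 4 (by norm_num)).div_const 24)).add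
    ((hasSum_pow 5 (by norm_num)).div_const 120)).sub ((hasSum_pow 6 (by norm_num)).div_const 720)).add
    ((hasSum_pow 7 (by norm_num)).div_const 5040)).add ((hasSum_pow 8 (by norm_num)).mul_right (9/322560)))
  have := (summable_F 1 zero_le_one).tsum_le_tsum (fun i => ?_) H.summable
  · refine this.trans (le_of_eq (H.tsum_eq.trans ?_)); norm_num
  · have := term_bound ((2:ℝ)⁻¹ ^ (i+1)) (by positivity) (pow_le_one₀ (by norm_num) (by norm_num))
    simp only [one_mul, pow_one]
    exact this

lemma F_two_pow (m : ℕ) : ∑' i : ℕ, (1 - Real.exp (-((2:ℝ)^m * (2:ℝ)⁻¹ ^ (i+1)))) =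
    m - ∑ j ∈ Finset.range m, Real.exp (-(2:ℝ)^j) + ∑' i : ℕ, (1 - Real.exp (-(1 * (2:ℝ)⁻¹ ^ (i+1)))) := by
  induction m with
  | zero => simp
  | succ m ih =>
    rw [(summable_F _ (by positivity)).tsum_eq_zero_add, Finset.sum_range_succ]
    have : ∀ i : ℕ, (2:ℝ)^(m+1) * (2:ℝ)⁻¹ ^ (i+1+1) = 2^m * (2:ℝ)⁻¹ ^ (i+1) := by
      intro i; rw [pow_succ, pow_succ _ (i+1)]; field_simp
    simp_rw [this]
    rw [ih]
    have h2 : (2:ℝ)^(m+1) * (2:ℝ)⁻¹ ^ (0+1) = 2^m := by rw [pow_succ, zero_add, pow_one]; ring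
    rw [h2]; push_cast; ring

lemma F_two_pow_le (m : ℕ) (hm : 4 ≤ m) :
    ∑' i : ℕ, (1 - Real.exp (-((2:ℝ)^m * (2:ℝ)⁻¹ ^ (i+1)))) ≤ m + 0.3327478 := by
  rw [F_two_pow]
  have h1 := A_bound
  have h2 : ∑ j ∈ Finset.range 4, Real.exp (-(2:ℝ)^j) ≤ ∑ j ∈ Finset.range m, Real.exp (-(2:ℝ)^j) :=
    Finset.sum_le_sum_of_subset_of_nonneg (by simpa using hm) (fun _ _ _ => (Real.exp_pos _).le)
  have hw : (1/2.7182818286 : ℝ) ≤ Real.exp (-1) := by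
    rw [Real.exp_neg, ← one_div]
    have := Real.exp_one_lt_d9
    have h0 := Real.exp_pos 1
    gcongr
  have h3 : ∀ j : ℕ, (1/2.7182818286 : ℝ) ^ (2 ^ j) ≤ Real.exp (-(2:ℝ)^j) := by
    intro j
    calc (1/2.7182818286 : ℝ) ^ (2 ^ j) ≤ Real.exp (-1) ^ (2^j) := by gcongr
      _ = _ := by rw [← Real.exp_nat_mul]; push_cast; ring_nf
  have h4 : ∑ j ∈ Finset.range 4, (1/2.7182818286 : ℝ) ^ (2 ^ j) ≤ ∑ j ∈ Finset.range 4, Real.exp (-(2:ℝ)^j) :=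
    Finset.sum_le_sum (fun j _ => h3 j)
  simp only [Finset.sum_range_succ, Finset.sum_range_zero] at h4
  norm_num at h1 h4 ⊢
  simp only [Finset.sum_range_succ, Finset.sum_range_zero] at h2
  norm_num at h2
  linarith

open Filter Topology in
lemma S_sub_F : ∀ᶠ n : ℕ in atTop, ∑' i : ℕ, (1 - (1 - (2 : ℝ)⁻¹ ^ (i + 1)) ^ n) ≤
    ∑' i : ℕ, (1 - Real.exp (-((n:ℝ) * (2:ℝ)⁻¹ ^ (i+1)))) + 0.000001 := by
  have hp : ∀ i : ℕ, 0 < (2:ℝ)⁻¹ ^ (i+1) ∧ (2:ℝ)⁻¹ ^ (i+1) ≤ 1/2 := by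
    intro i
    refine ⟨by positivity, ?_⟩
    rw [pow_succ]
    have : (2:ℝ)⁻¹ ^ i ≤ 1 := pow_le_one₀ (by norm_num) (by norm_num)
    linarith
  have hub : ∀ (n : ℕ) (p : ℝ), 0 < p → p ≤ 1/2 → (1 - p) ^ n ≤ Real.exp (-(n * p)) := by
    intro n p h0 h1
    have := Real.one_sub_le_exp_neg p
    calc (1-p)^n ≤ Real.exp (-p) ^ n := by gcongr; linarith
      _ = _ := by rw [← Real.exp_nat_mul]; ring_nf
  have hlb : ∀ (n : ℕ) (p : ℝ), 0 < p → p ≤ 1/2 →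
      Real.exp (-(n * p)) - (1 - p) ^ n ≤ 2 * p := by
    intro n p h0 h1
    -- `1 - p ≥ exp(-p - 2p²)`
    have hb : Real.exp (-(p + 2 * p^2)) ≤ 1 - p := by
      have h2 := Real.one_sub_inv_le_log_of_pos (x := 1 - p) (by linarith)
      rw [← Real.le_log_iff_exp_le (by linarith)]
      refine le_trans ?_ h2
      have : (1 - p)⁻¹ ≤ 1 + p + 2 * p^2 := by
        rw [inv_le_iff_one_le_mul₀ (by linarith)]
        nlinarith [sq_nonneg p, mul_nonneg (sq_nonneg p) (sub_nonneg.mpr h1)]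
      linarith
    have h3 : Real.exp (-(n*p)) * Real.exp (-(2 * n * p^2)) ≤ (1-p)^n := by
      calc _ = Real.exp (-(p + 2 * p^2)) ^ n := by
            rw [← Real.exp_nat_mul, ← Real.exp_add]; ring_nf
        _ ≤ _ := by gcongr
    have h4 := Real.one_sub_le_exp_neg (2 * n * p^2)
    have h5 : Real.exp (-(n*p)) * (n * p) ≤ 1 := by
      rw [Real.exp_neg, inv_mul_le_iff₀ (Real.exp_pos _)]
      have := Real.add_one_le_exp (n * p); linarith
    have h6 := (Real.exp_pos (-(n*p))).le
    nlinarith [mul_le_mul_of_nonneg_left h4 h6, mul_le_mul_of_nonneg_left h5 h0.le]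
  have hsum := ((hasSum_pow 1 one_ne_zero).summable).mul_left 2
  simp only [pow_one] at hsum
  have hT := tendsto_tsum_of_dominated_convergence (𝓕 := atTop) (f := fun (n : ℕ) (i : ℕ) =>
    Real.exp (-((n:ℝ) * (2:ℝ)⁻¹ ^ (i+1))) - (1 - (2 : ℝ)⁻¹ ^ (i + 1)) ^ n) (g := fun _ => 0) hsum
    (fun i => by
      obtain ⟨h0, h1⟩ := hp i
      have t1 : Tendsto (fun n : ℕ => Real.exp (-((n:ℝ) * (2:ℝ)⁻¹ ^ (i+1)))) atTop (𝓝 0) :=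
        Real.tendsto_exp_neg_atTop_nhds_zero.comp
          (tendsto_natCast_atTop_atTop.atTop_mul_const h0)
      have t2 : Tendsto (fun n : ℕ => (1 - (2 : ℝ)⁻¹ ^ (i + 1)) ^ n) atTop (𝓝 0) :=
        tendsto_pow_atTop_nhds_zero_of_lt_one (by linarith) (by linarith)
      simpa using t1.sub t2)
    (Eventually.of_forall fun n i => by
      obtain ⟨h0, h1⟩ := hp i
      rw [Real.norm_of_nonneg (sub_nonneg.mpr (hub n _ h0 h1))]
      exact hlb n _ h0 h1)
  rw [tsum_zero] at hT
  filter_upwards [hT.eventually_lt_const (show (0:ℝ) < 0.000001 by norm_num)] with n hn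
  have hs : Summable (fun i : ℕ => Real.exp (-((n:ℝ) * (2:ℝ)⁻¹ ^ (i+1))) - (1 - (2 : ℝ)⁻¹ ^ (i + 1)) ^ n) :=
    Summable.of_nonneg_of_le (fun i => sub_nonneg.mpr (hub n _ (hp i).1 (hp i).2))
      (fun i => hlb n _ (hp i).1 (hp i).2) hsum
  have hF := summable_F n (Nat.cast_nonneg n)
  have e : ∀ i : ℕ, (1 - (1 - (2 : ℝ)⁻¹ ^ (i + 1)) ^ n) = (1 - Real.exp (-((n:ℝ) * (2:ℝ)⁻¹ ^ (i+1)))) +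
    (Real.exp (-((n:ℝ) * (2:ℝ)⁻¹ ^ (i+1))) - (1 - (2 : ℝ)⁻¹ ^ (i + 1)) ^ n) := fun i => by ring
  simp_rw [e]
  rw [hF.tsum_add hs]
  linarith

open FourierTransform in
lemma fourier_g (w : ℝ) :
    𝓕 (fun t : ℝ => ((Real.exp (-(Real.log 2 * t)) * Real.exp (-Real.exp (-(Real.log 2 * t))) : ℝ) : ℂ)) w
      = (1 / Real.log 2 : ℝ) * Complex.Gamma (1 + ((2 * Real.pi * w / Real.log 2 : ℝ) : ℂ) * Complex.I) := by
  have hL : 0 < Real.log 2 := Real.log_pos (by norm_num)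
  have hG : ∀ b : ℝ, Complex.Gamma (1 + (b : ℂ) * Complex.I) =
      𝓕 (fun u : ℝ => ((Real.exp (-u) * Real.exp (-Real.exp (-u)) : ℝ) : ℂ)) (b / (2 * Real.pi)) := by
    intro b
    rw [Complex.Gamma_eq_integral (by simp), Complex.GammaIntegral_eq_mellin, mellin_eq_fourier]
    simp
  have hw : 2 * Real.pi * w / Real.log 2 / (2 * Real.pi) = w / Real.log 2 := by
    field_simp
  rw [hG, hw, Real.fourier_real_eq, Real.fourier_real_eq]
  have := MeasureTheory.Measure.integral_comp_mul_left (fun v : ℝ => Real.fourierChar (-(v * (w / Real.log 2))) •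
    ((Real.exp (-v) * Real.exp (-Real.exp (-v)) : ℝ) : ℂ)) (Real.log 2)
  rw [abs_of_pos (inv_pos.mpr hL)] at this
  rw [one_div, ← Complex.real_smul, ← this]
  congr 1
  ext t
  congr 3
  field_simp

open FourierTransform Filter Asymptotics in
lemma poisson_bound (x : ℝ) (K : Finset ℤ) :
    ∑ k ∈ K, Real.exp (-(Real.log 2 * (x + k))) * Real.exp (-Real.exp (-(Real.log 2 * (x + k))))
      ≤ (1 + 0.0000106) / Real.log 2 := by
  have hL : 0 < Real.log 2 := Real.log_pos (by norm_num)
  set r : ℝ → ℝ := fun t => Real.exp (-(Real.log 2 * t)) * Real.exp (-Real.exp (-(Real.log 2 * t))) with hr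
  set g : ℝ → ℂ := fun t : ℝ => ((r t : ℝ) : ℂ) with hg
  have hrpos : ∀ t, 0 < r t := fun t => by positivity
  have hcont : Continuous g := by
    simp only [hg, hr]; fun_prop
  -- decay
  have hdec : ∀ t, r t ≤ Real.exp (-(Real.log 2 * |t|)) := by
    intro t
    rcases abs_cases t with ⟨h, _⟩ | ⟨h, _⟩ <;> rw [h]
    · apply mul_le_of_le_one_right (Real.exp_pos _).le
      exact Real.exp_le_one_iff.mpr (by have := Real.exp_pos (-(Real.log 2 * t)); linarith)
    · have h1 : ∀ y : ℝ, y ^ 2 * Real.exp (-y) ≤ 1 ∨ y < 0 := by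
        intro y
        by_cases hy : 0 ≤ y
        · left
          rw [Real.exp_neg, mul_inv_le_iff₀ (Real.exp_pos _), one_mul]
          have h2 := Real.add_one_le_exp (y/2)
          have h5 := Real.sum_le_exp_of_nonneg hy 4
          simp [Finset.sum_range_succ, Nat.factorial] at h5
          nlinarith [mul_nonneg hy (sq_nonneg (y-2)), mul_nonneg hy (sq_nonneg (y-3)), sq_nonneg (y-2), mul_nonneg hy hy]
        · right; linarith
      have h2 := (h1 (Real.exp (-(Real.log 2 * t)))).resolve_right (by have := Real.exp_pos (-(Real.log 2 * t)); linarith)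
      rw [show -(Real.log 2 * -t) = -(-(Real.log 2 * t)) by ring, Real.exp_neg (-(Real.log 2 * t))]
      rw [← one_div, le_div_iff₀ (Real.exp_pos _)]
      calc _ = Real.exp (-(Real.log 2 * t)) ^ 2 * Real.exp (-Real.exp (-(Real.log 2 * t))) := by
            simp only [hr]; ring
        _ ≤ 1 := h2
  have hO : g =O[cocompact ℝ] fun x : ℝ => |x| ^ (-(2:ℝ)) := by
    have h1 : (fun t : ℝ => Real.exp (-Real.log 2 * t)) =O[atTop] fun t : ℝ => t ^ (-(2:ℝ)) :=
      (isLittleO_exp_neg_mul_rpow_atTop hL (-2)).isBigO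
    have h2 := h1.comp_tendsto (tendsto_norm_cocompact_atTop (E := ℝ))
    refine IsBigO.trans (IsBigO.of_bound 1 (Eventually.of_forall fun t => ?_)) h2
    simp only [hg, Complex.norm_real, Function.comp, one_mul, Real.norm_eq_abs]
    rw [abs_of_pos (hrpos t), abs_of_pos (Real.exp_pos _), neg_mul]
    exact hdec t
  have hF : ∀ w : ℝ, 𝓕 g w = (1 / Real.log 2 : ℝ) * Complex.Gamma (1 + ((2 * Real.pi * w / Real.log 2 : ℝ) : ℂ) * Complex.I) :=
    fun w => fourier_g w
  have hb : ∀ n : ℤ, n ≠ 0 → ‖𝓕 g n‖ ≤ 1 / Real.log 2 * (0.0000052 * (1/100) ^ (n.natAbs - 1)) := by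
    intro n hn
    rw [hF, norm_mul, Complex.norm_real, Real.norm_of_nonneg (by positivity)]
    gcongr
    apply gamma_bound n.natAbs (by simpa using hn)
    rw [abs_div, abs_mul, abs_of_pos hL, abs_of_pos (by positivity : 0 < 2 * Real.pi), Nat.cast_natAbs]
    simp
  have hgeo : HasSum (fun n : ℕ => 1 / Real.log 2 * (0.0000052 * (1/100 : ℝ) ^ n)) (1 / Real.log 2 * (0.0000052 * (1 - 1/100)⁻¹)) :=
    ((hasSum_geometric_of_lt_one (by norm_num) (by norm_num)).mul_left _).mul_left _
  have hbp : ∀ n : ℕ, ‖𝓕 g ((n + 1 : ℕ) : ℤ)‖ ≤ 1 / Real.log 2 * (0.0000052 * (1/100) ^ n) := by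
    intro n
    have := hb ((n+1 : ℕ) : ℤ) (by omega)
    rwa [Int.natAbs_natCast, Nat.add_sub_cancel] at this
  have hbm : ∀ n : ℕ, ‖𝓕 g ((-(n + 1 : ℤ) : ℤ) : ℝ)‖ ≤ 1 / Real.log 2 * (0.0000052 * (1/100) ^ n) := by
    intro n
    have := hb (-(n + 1 : ℤ)) (by omega)
    rwa [show (-(n + 1 : ℤ)).natAbs - 1 = n by omega] at this
  have sp : Summable (fun n : ℕ => 𝓕 g (((n + 1 : ℕ) : ℤ) : ℝ)) :=
    Summable.of_norm_bounded hgeo.summable hbp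
  have sm : Summable (fun n : ℕ => 𝓕 g ((-(n + 1 : ℤ) : ℤ) : ℝ)) :=
    Summable.of_norm_bounded hgeo.summable hbm
  have sp0 : Summable (fun n : ℕ => 𝓕 g ((n : ℤ) : ℝ)) :=
    (summable_nat_add_iff (f := fun n : ℕ => 𝓕 g ((n : ℤ) : ℝ)) 1).mp sp
  have hsumF : Summable (fun n : ℤ => 𝓕 g n) := Summable.of_nat_of_neg_add_one sp0 sm
  have hP := Real.tsum_eq_tsum_fourier_of_rpow_decay_of_summable hcont one_lt_two hO hsumF x
  -- norm of the right side
  have hfn : ∀ n : ℤ, ‖fourier n (x : UnitAddCircle)‖ = 1 := fun n => by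
    rw [fourier_apply]; exact Circle.norm_coe _
  have hfnn : ∀ n : ℤ, ‖𝓕 g n * fourier n (x : UnitAddCircle)‖ = ‖𝓕 g n‖ := fun n => by
    rw [norm_mul, hfn, mul_one]
  have hnorm : ‖∑' n : ℤ, 𝓕 g n * fourier n (x : UnitAddCircle)‖ ≤ ∑' n : ℤ, ‖𝓕 g n‖ := by
    refine (norm_tsum_le_tsum_norm ?_).trans (le_of_eq ?_)
    · simp_rw [hfnn]; exact hsumF.norm
    · simp_rw [hfnn]
  have hg0 : ‖𝓕 g ((0 : ℤ) : ℝ)‖ = 1 / Real.log 2 := by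
    rw [hF, norm_mul, Complex.norm_real, Real.norm_of_nonneg (by positivity)]; simp
  have htot : ∑' n : ℤ, ‖𝓕 g n‖ ≤ 1 / Real.log 2 + 2 * (1 / Real.log 2 * (0.0000052 * (1 - 1/100)⁻¹)) := by
    rw [tsum_of_nat_of_neg_add_one (f := fun n : ℤ => ‖𝓕 g n‖) sp0.norm sm.norm, sp0.norm.tsum_eq_zero_add]
    have a1 := sp.norm.tsum_le_tsum hbp hgeo.summable
    have a2 := sm.norm.tsum_le_tsum hbm hgeo.summable
    rw [hgeo.tsum_eq] at a1 a2
    have a0 : ‖𝓕 g (((0 : ℕ) : ℤ) : ℝ)‖ = 1 / Real.log 2 := hg0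
    rw [a0]
    linarith
  -- left side
  have hsumr : Summable (fun n : ℤ => r (x + n)) := by
    have h1 : Summable (fun n : ℤ => ‖g (x + n)‖) := by
      have h2 := summable_of_isBigO (Real.summable_abs_int_rpow one_lt_two)
        ((isBigO_norm_restrict_cocompact ⟨_, hcont⟩ (zero_lt_two) hO ⟨{x}, isCompact_singleton⟩).comp_tendsto
          Int.tendsto_coe_cofinite)
      refine Summable.of_nonneg_of_le (fun _ => norm_nonneg _) (fun n => ?_) h2
      exact ContinuousMap.norm_coe_le_norm (((⟨g, hcont⟩ : C(ℝ, ℂ)).comp (ContinuousMap.addRight (n:ℝ))).restrict {x}) ⟨x, rfl⟩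
    refine h1.congr fun n => ?_
    simp only [hg, Complex.norm_real, Real.norm_of_nonneg (hrpos _).le]
  have hle := hsumr.sum_le_tsum K (fun n _ => (hrpos _).le)
  have hreal : ∑' n : ℤ, r (x + n) ≤ ‖∑' n : ℤ, g (x + n)‖ := by
    have : ∑' n : ℤ, g (x + n) = ((∑' n : ℤ, r (x + n) : ℝ) : ℂ) := by
      simp only [hg]; rw [Complex.ofReal_tsum]
    rw [this, Complex.norm_real]; exact le_abs_self _
  rw [hP] at hreal
  refine (hle.trans (hreal.trans (hnorm.trans htot))).trans ?_
  rw [show (1 + 0.0000106) / Real.log 2 = (1 + 0.0000106) * (1 / Real.log 2) by ring]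
  have : 0 < 1 / Real.log 2 := by positivity
  generalize 1 / Real.log 2 = c at this ⊢
  norm_num at this ⊢
  linarith

lemma deriv_bound (y : ℝ) (hy : 0 < y) (K : Finset ℕ) :
    ∑ i ∈ K, (2:ℝ)⁻¹ ^ (i+1) * Real.exp (-(y * (2:ℝ)⁻¹ ^ (i+1))) ≤ (1 + 0.0000106) / Real.log 2 * y⁻¹ := by
  have hL : 0 < Real.log 2 := Real.log_pos (by norm_num)
  have h := poisson_bound (-(Real.log y / Real.log 2))
    (K.map ⟨fun i : ℕ => ((i + 1 : ℕ) : ℤ), fun a b hab => by simpa using hab⟩)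
  rw [Finset.sum_map] at h
  have e : ∀ i : ℕ, Real.exp (-(Real.log 2 * (-(Real.log y / Real.log 2) + (((i + 1 : ℕ) : ℤ) : ℝ)))) =
      y * (2:ℝ)⁻¹ ^ (i+1) := by
    intro i
    have : -(Real.log 2 * (-(Real.log y / Real.log 2) + (((i + 1 : ℕ) : ℤ) : ℝ))) =
      Real.log y + ((i + 1 : ℕ) : ℝ) * (-Real.log 2) := by
      push_cast; field_simp; ring
    rw [this, Real.exp_add, Real.exp_log hy, Real.exp_nat_mul, Real.exp_neg, Real.exp_log two_pos]
  replace h : ∑ i ∈ K, Real.exp (-(Real.log 2 * (-(Real.log y / Real.log 2) + (((i + 1 : ℕ) : ℤ) : ℝ)))) *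
      Real.exp (-Real.exp (-(Real.log 2 * (-(Real.log y / Real.log 2) + (((i + 1 : ℕ) : ℤ) : ℝ))))) ≤
      (1 + 0.0000106) / Real.log 2 := h
  simp_rw [e] at h
  rw [← div_eq_mul_inv, le_div_iff₀ hy, Finset.sum_mul]
  refine le_trans (le_of_eq (Finset.sum_congr rfl fun i _ => ?_)) h
  ring

lemma F_mono (a b : ℝ) (ha : 0 < a) (hab : a ≤ b) :
    ∑' i : ℕ, (1 - Real.exp (-(b * (2:ℝ)⁻¹ ^ (i+1)))) ≤
    ∑' i : ℕ, (1 - Real.exp (-(a * (2:ℝ)⁻¹ ^ (i+1)))) +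
      (1 + 0.0000106) / Real.log 2 * (Real.log b - Real.log a) := by
  refine (summable_F b (ha.le.trans hab)).tsum_le_of_sum_le fun K => ?_
  set C : ℝ := (1 + 0.0000106) / Real.log 2 with hC
  have hd : ∀ y : ℝ, 0 < y → HasDerivAt
      (fun y => ∑ i ∈ K, Real.exp (-(y * (2:ℝ)⁻¹ ^ (i+1))) + C * Real.log y)
      (∑ i ∈ K, Real.exp (-(y * (2:ℝ)⁻¹ ^ (i+1))) * (-(1 * (2:ℝ)⁻¹ ^ (i+1))) + C * y⁻¹) y := by
    intro y hy
    refine HasDerivAt.add (HasDerivAt.fun_sum fun i _ => ?_) ((Real.hasDerivAt_log hy.ne').const_mul C)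
    exact ((hasDerivAt_id y).mul_const _).neg.exp
  have hm : MonotoneOn (fun y => ∑ i ∈ K, Real.exp (-(y * (2:ℝ)⁻¹ ^ (i+1))) + C * Real.log y)
      (Set.Ioi 0) := by
    refine monotoneOn_of_deriv_nonneg (convex_Ioi 0)
      (fun y hy => (hd y hy).continuousAt.continuousWithinAt) ?_ ?_
    · intro y hy
      rw [interior_Ioi] at hy
      exact (hd y hy).differentiableAt.differentiableWithinAt
    · intro y hy
      rw [interior_Ioi] at hy
      rw [(hd y hy).deriv]
      have h := deriv_bound y hy K
      rw [← hC] at h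
      have e : ∑ i ∈ K, Real.exp (-(y * (2:ℝ)⁻¹ ^ (i+1))) * (-(1 * (2:ℝ)⁻¹ ^ (i+1))) =
        -∑ i ∈ K, (2:ℝ)⁻¹ ^ (i+1) * Real.exp (-(y * (2:ℝ)⁻¹ ^ (i+1))) := by
        rw [← Finset.sum_neg_distrib]
        exact Finset.sum_congr rfl fun i _ => by ring
      rw [e]; linarith
  have h1 := hm (Set.mem_Ioi.mpr ha) (Set.mem_Ioi.mpr (ha.trans_le hab)) hab
  have h2 := (summable_F a ha.le).sum_le_tsum K (fun i _ => by
    have : Real.exp (-(a * (2:ℝ)⁻¹ ^ (i+1))) ≤ 1 := Real.exp_le_one_iff.mpr (by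
      have : 0 ≤ a * (2:ℝ)⁻¹ ^ (i+1) := by positivity
      linarith)
    linarith)
  simp only [Finset.sum_sub_distrib] at h2 ⊢
  simp only at h1
  linarith

/-- **Proposition 2, second part:**
`limsup_{n → ∞} (S(n) − log₂ n) ≤ 0.33276`. -/
theorem limsup_S_sub_log_le :
    Filter.limsup (fun n : ℕ => S n - Real.logb 2 n) Filter.atTop ≤ 0.33276 := by
  have hL : 0 < Real.log 2 := Real.log_pos (by norm_num)
  have hev : ∀ᶠ n : ℕ in Filter.atTop, S n - Real.logb 2 n ≤ 0.33276 := by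
    filter_upwards [S_sub_F, Filter.eventually_ge_atTop 16] with n hn h16
    have hn0 : n ≠ 0 := by omega
    have h4 : 4 ≤ Nat.log 2 n := Nat.le_log_of_pow_le (by norm_num) (by simpa using h16)
    set m := Nat.log 2 n with hm
    have hlo : ((2:ℝ)^m) ≤ n := by exact_mod_cast Nat.pow_log_le_self 2 hn0
    have hhi : (n:ℝ) < 2^(m+1) := by exact_mod_cast Nat.lt_pow_succ_log_self (by norm_num) n
    have h1 := F_mono (2^m) n (by positivity) hlo
    have h2 := F_two_pow_le m h4
    have hnpos : (0:ℝ) < n := by positivity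
    have h3 : Real.log n ≤ (m + 1) * Real.log 2 := by
      have := Real.log_le_log hnpos hhi.le
      rw [Real.log_pow] at this; exact_mod_cast this
    rw [Real.log_pow] at h1
    have h5 : Real.logb 2 n ≤ m + 1 := by
      rw [Real.logb, div_le_iff₀ hL]; exact h3
    have h6 : (1 + 0.0000106) / Real.log 2 * (Real.log n - m * Real.log 2) =
        (1 + 0.0000106) * (Real.logb 2 n - m) := by
      rw [Real.logb]; field_simp
    rw [h6] at h1
    unfold S
    norm_num at hn h1 h2 ⊢
    linarith
  by_cases hc : Filter.IsCoboundedUnder (· ≤ ·) Filter.atTop (fun n : ℕ => S n - Real.logb 2 n)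
  · exact Filter.limsup_le_of_le hc hev
  · rw [Filter.limsup_eq, Real.sInf_of_not_bddBelow]
    · norm_num
    · rintro ⟨b, hb⟩
      exact hc ⟨b, fun a ha => hb (by simpa using ha)⟩
end
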